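/- arXiv:1707.08802 — 4 statements merged into one kernel-verified Lean document; each statement's English description precedes it below -/
import Mathlib

section
/- Let $X_1, \ldots, X_N$ be real-valued exchangeable random variables on a probability space, i.e., for every permutation $\pi$ of $\{1,\ldots,N\}$ the joint distribution of $(X_{\pi(1)}, \ldots, X_{\pi(N)})$ equals that of $(X_1, \ldots, X_N)$. Let $a = (a_1, \ldots, a_N)$ and $b = (b_1, \ldots, b_N)$ be vectors of real constants such that $b$ majorizes $a$. Then $\sum_{i=1}^{N} a_i X_i \le_{cx} \sum_{i=1}^{N} b_i X_i$, i.e., for every convex function $\phi : \mathbb{R} \to \mathbb{R}$ such that both expectations exist, $E[\phi(\sum_{i=1}^{N} a_i X_i)] \le E[\phi(\sum_{i=1}^{N} b_i X_i)]$. -/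
open Matrix MeasureTheory

/-- `x` majorizes `y` iff `y = S x` for some doubly stochastic matrix `S`. -/
def Majorizes {n : ℕ} (x y : Fin n → ℝ) : Prop :=
  ∃ S ∈ doublyStochastic ℝ (Fin n), y = S.mulVec x

/-- if `X₁, …, X_N` are exchangeable real random variables and `b`
majorizes `a`, then `∑ aᵢ Xᵢ ≤_cx ∑ bᵢ Xᵢ`: for every convex `φ : ℝ → ℝ` with both
expectations existing, `E[φ(∑ aᵢ Xᵢ)] ≤ E[φ(∑ bᵢ Xᵢ)]`. -/
theorem stmt_2 {Ω : Type*} [MeasurableSpace Ω] (μ : Measure Ω) [IsProbabilityMeasure μ]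
    {N : ℕ} (X : Fin N → Ω → ℝ) (hX : ∀ i, Measurable (X i))
    (hexch : ∀ σ : Equiv.Perm (Fin N),
      Measure.map (fun ω (i : Fin N) => X (σ i) ω) μ =
        Measure.map (fun ω (i : Fin N) => X i ω) μ)
    (a b : Fin N → ℝ) (hmaj : Majorizes b a)
    (φ : ℝ → ℝ) (hφ : ConvexOn ℝ Set.univ φ)
    (hinta : Integrable (fun ω => φ (∑ i, a i * X i ω)) μ)
    (hintb : Integrable (fun ω => φ (∑ i, b i * X i ω)) μ) :
    ∫ ω, φ (∑ i, a i * X i ω) ∂μ ≤ ∫ ω, φ (∑ i, b i * X i ω) ∂μ := by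
  obtain ⟨S, hS, rfl⟩ := hmaj
  obtain ⟨w, hw0, hw1, rfl⟩ := exists_eq_sum_perm_of_mem_doublyStochastic hS
  have hc : Continuous φ := by
    rw [← continuousOn_univ]
    exact hφ.continuousOn isOpen_univ
  set F : (Fin N → ℝ) → ℝ := fun x => φ (∑ i, b i * x i) with hF
  have hFm : Continuous F := by
    rw [hF]; fun_prop
  have hXm : ∀ σ : Equiv.Perm (Fin N), Measurable (fun ω (i : Fin N) => X (σ i) ω) :=
    fun σ => measurable_pi_lambda _ (fun i => hX _)
  have hXm1 : Measurable (fun ω (i : Fin N) => X i ω) :=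
    measurable_pi_lambda _ (fun i => hX _)
  have hIF : Integrable F (Measure.map (fun ω (i : Fin N) => X i ω) μ) :=
    (integrable_map_measure hFm.aestronglyMeasurable hXm1.aemeasurable).2 hintb
  have hi : ∀ σ : Equiv.Perm (Fin N), Integrable (fun ω => F (fun i => X (σ i) ω)) μ := by
    intro σ
    rw [← hexch σ] at hIF
    exact (integrable_map_measure hFm.aestronglyMeasurable (hXm σ).aemeasurable).1 hIF
  have he : ∀ σ : Equiv.Perm (Fin N), ∫ ω, F (fun i => X (σ i) ω) ∂μ
      = ∫ ω, φ (∑ i, b i * X i ω) ∂μ := by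
    intro σ
    have h1 := integral_map (hXm σ).aemeasurable
      (hFm.aestronglyMeasurable (μ := Measure.map (fun ω (i : Fin N) => X (σ i) ω) μ))
    have h2 := integral_map hXm1.aemeasurable
      (hFm.aestronglyMeasurable (μ := Measure.map (fun ω (i : Fin N) => X i ω) μ))
    rw [← h1, hexch σ, h2]
  have hpt : ∀ ω, φ (∑ i, ((∑ σ : Equiv.Perm (Fin N), w σ • σ.permMatrix ℝ) *ᵥ b) i * X i ω)
      ≤ ∑ σ : Equiv.Perm (Fin N), w σ * F (fun i => X (σ⁻¹ i) ω) := by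
    intro ω
    have h := hφ.map_sum_le (t := Finset.univ) (w := w)
      (p := fun σ : Equiv.Perm (Fin N) => ∑ i, b i * X (σ⁻¹ i) ω)
      (fun σ _ => hw0 σ) hw1 (fun _ _ => Set.mem_univ _)
    simp only [smul_eq_mul] at h
    refine le_trans (le_of_eq (congrArg φ ?_)) h
    simp only [Matrix.sum_mulVec, Matrix.smul_mulVec, Matrix.permMatrix_mulVec, Finset.sum_apply,
      Pi.smul_apply, smul_eq_mul, Function.comp, Finset.sum_mul]
    rw [Finset.sum_comm]
    refine Finset.sum_congr rfl fun σ _ => ?_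
    rw [Finset.mul_sum, ← Equiv.sum_comp σ (fun i => w σ * (b i * X (σ⁻¹ i) ω))]
    simp [mul_assoc]
  calc _ ≤ ∫ ω, ∑ σ : Equiv.Perm (Fin N), w σ * F (fun i => X (σ⁻¹ i) ω) ∂μ :=
        integral_mono hinta
          (integrable_finsetSum _ fun σ _ => (hi σ⁻¹).const_mul _) hpt
    _ = ∑ σ : Equiv.Perm (Fin N), w σ * ∫ ω, φ (∑ i, b i * X i ω) ∂μ := by
        rw [integral_finsetSum _ fun σ _ => (hi σ⁻¹).const_mul _]
        refine Finset.sum_congr rfl fun σ _ => ?_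
        rw [integral_const_mul, he]
    _ = _ := by rw [← Finset.sum_mul, hw1, one_mul]
end

section
/- (Coverage comparison for a Rayleigh-faded user.) Let $D$ be an $N \times N$ real diagonal matrix with nonnegative diagonal entries $\lambda_1, \ldots, \lambda_N$, let $C$ be an $N \times N$ real symmetric positive semidefinite matrix with all diagonal entries equal to $1$, and let $\hat{\lambda}_1, \ldots, \hat{\lambda}_N$ be the eigenvalues of $D^{1/2} C D^{1/2}$ (equivalently, of $DC$). Then for every nonnegative constant $k$ and every $m_c > 0$, $\prod_{i=1}^{N} \left(\frac{1}{1 + k \hat{\lambda}_i}\right)^{m_c} \ge \prod_{i=1}^{N} \left(\frac{1}{1 + k \lambda_i}\right)^{m_c}$. -/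
open Matrix

/-- coverage comparison for a Rayleigh-faded user: let `D = diagonal lam`
with `lam ≥ 0`, let `C` be symmetric positive semidefinite with unit diagonal, and let
`lamHat` be the eigenvalues of `D^{1/2} C D^{1/2}` (equivalently of `D C`).  Then for
every `k ≥ 0` and `m_c > 0`,
`∏ᵢ (1/(1 + k lamHatᵢ))^{m_c} ≥ ∏ᵢ (1/(1 + k lamᵢ))^{m_c}`. -/
theorem stmt_7 {N : ℕ} (lam : Fin N → ℝ) (hlam : ∀ i, 0 ≤ lam i)
    (C : Matrix (Fin N) (Fin N) ℝ) (hC : C.PosSemidef) (hCdiag : ∀ i, C i i = 1)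
    (hM : (Matrix.diagonal (fun i => Real.sqrt (lam i)) * C *
        Matrix.diagonal (fun i => Real.sqrt (lam i))).IsHermitian)
    (k mc : ℝ) (hk : 0 ≤ k) (hmc : 0 < mc) :
    ∏ i, (1 / (1 + k * lam i)) ^ mc ≤ ∏ i, (1 / (1 + k * hM.eigenvalues i)) ^ mc := by

  set M := Matrix.diagonal (fun i => Real.sqrt (lam i)) * C *
        Matrix.diagonal (fun i => Real.sqrt (lam i)) with hMdef
  have hpsd : M.PosSemidef := by
    have h := hC.mul_mul_conjTranspose_same (Matrix.diagonal (fun i => Real.sqrt (lam i)))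
    simpa [Matrix.diagonal_conjTranspose, hMdef] using h
  have hmu : ∀ j, 0 ≤ hM.eigenvalues j := fun j => hpsd.eigenvalues_nonneg j
  have hdiag : ∀ i, M i i = lam i := by
    intro i
    simp only [hMdef, Matrix.mul_diagonal, Matrix.diagonal_mul, hCdiag, mul_one]
    exact Real.mul_self_sqrt (hlam i)
  set U : Matrix (Fin N) (Fin N) ℝ := (hM.eigenvectorUnitary).1 with hU
  have hUU : U * star U = 1 := Unitary.mul_star_self_of_mem hM.eigenvectorUnitary.2
  have hUU' : star U * U = 1 := Unitary.star_mul_self_of_mem hM.eigenvectorUnitary.2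
  have hrow : ∀ i, ∑ j, U i j ^ 2 = 1 := by
    intro i
    have h := congrFun (congrFun hUU i) i
    simpa [Matrix.mul_apply, Matrix.star_apply, sq] using h
  have hcol : ∀ j, ∑ i, U i j ^ 2 = 1 := by
    intro i
    have h := congrFun (congrFun hUU' i) i
    simpa [Matrix.mul_apply, Matrix.star_apply, sq] using h
  have hspec : ∀ i, lam i = ∑ j, U i j ^ 2 * hM.eigenvalues j := by
    intro i
    have h := congrFun (congrFun hM.spectral_theorem i) i
    rw [hdiag, Unitary.conjStarAlgAut_apply, Matrix.mul_apply] at h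
    rw [h]
    refine Finset.sum_congr rfl fun j _ => ?_
    simp [hU, Matrix.mul_diagonal, Matrix.star_apply]
    ring
  have hpos : ∀ j, 0 < 1 + k * hM.eigenvalues j := fun j => by
    have := mul_nonneg hk (hmu j)
    linarith
  have hpos' : ∀ j, 0 < 1 + k * lam j := fun j => by
    have := mul_nonneg hk (hlam j)
    linarith
  have key : ∏ j, (1 + k * hM.eigenvalues j) ≤ ∏ i, (1 + k * lam i) := by
    calc ∏ j, (1 + k * hM.eigenvalues j)
        = ∏ j, ∏ i, (1 + k * hM.eigenvalues j) ^ (U i j ^ 2) := by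
          refine Finset.prod_congr rfl fun j _ => ?_
          rw [← Real.rpow_sum_of_pos (hpos j), hcol, Real.rpow_one]
      _ = ∏ i, ∏ j, (1 + k * hM.eigenvalues j) ^ (U i j ^ 2) := Finset.prod_comm
      _ ≤ ∏ i, (1 + k * lam i) := by
          refine Finset.prod_le_prod
            (fun i _ => Finset.prod_nonneg fun j _ => Real.rpow_nonneg (hpos j).le _)
            fun i _ => ?_
          refine (Real.geom_mean_le_arith_mean_weighted Finset.univ _ _
            (fun j _ => sq_nonneg _) (hrow i) (fun j _ => (hpos j).le)).trans_eq ?_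
          rw [hspec i, Finset.mul_sum, ← hrow i, ← Finset.sum_add_distrib]
          exact Finset.sum_congr rfl fun j _ => by rw [hrow i]; ring
  rw [Real.finsetProd_rpow _ _ (fun i _ => (one_div_pos.2 (hpos' i)).le),
    Real.finsetProd_rpow _ _ (fun i _ => (one_div_pos.2 (hpos i)).le)]
  refine Real.rpow_le_rpow (Finset.prod_nonneg fun i _ => (one_div_pos.2 (hpos' i)).le) ?_ hmc.le
  simp only [one_div, Finset.prod_inv_distrib]
  exact inv_anti₀ (Finset.prod_pos fun j _ => hpos j) key
end

section
/- Let $k \ge 0$, let $N \ge 1$, and let $a_1, \ldots, a_N$ be positive real exponents. Then the symmetrized function $\psi(x_1, \ldots, x_N) = \sum_{\sigma \in S_N} \prod_{i=1}^{N} \left(1 + k x_{\sigma(i)}\right)^{-a_i}$, where the sum is over all permutations $\sigma$ of $\{1, \ldots, N\}$, is Schur-convex on the nonnegative orthant: if $x, y \in [0,\infty)^N$ and $x$ majorizes $y$, then $\psi(x) \ge \psi(y)$. -/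
open Matrix

lemma aux_convex {N : ℕ} (k : ℝ) (hk : 0 ≤ k) (a : Fin N → ℝ) (ha : ∀ i, 0 < a i) :
    ConvexOn ℝ {z : Fin N → ℝ | ∀ i, 0 ≤ z i} (fun z => ∏ i, (1 + k * z i) ^ (-(a i))) := by
  have hg : ∀ z : Fin N → ℝ, (∀ i, 0 ≤ z i) → ∏ i, (1 + k * z i) ^ (-(a i)) =
      Real.exp (∑ i, Real.log (1 + k * z i) * (-(a i))) := by
    intro z hz
    rw [Real.exp_sum]
    refine Finset.prod_congr rfl fun i _ => ?_
    rw [Real.rpow_def_of_pos]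
    have := mul_nonneg hk (hz i)
    linarith
  have hS : Convex ℝ {z : Fin N → ℝ | ∀ i, 0 ≤ z i} := by
    intro u hu v hv p q hp hq hpq i
    have h1 := mul_nonneg hp (hu i)
    have h2 := mul_nonneg hq (hv i)
    simp only [Pi.add_apply, Pi.smul_apply, smul_eq_mul]
    linarith
  refine ⟨hS, ?_⟩
  intro u hu v hv p q hp hq hpq
  have huv := hS hu hv hp hq hpq
  show ∏ i, (1 + k * (p • u + q • v) i) ^ (-(a i)) ≤ p • (∏ i, (1 + k * u i) ^ (-(a i))) +
    q • (∏ i, (1 + k * v i) ^ (-(a i)))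
  rw [hg _ huv, hg _ hu, hg _ hv]
  refine le_trans (Real.exp_le_exp.2 ?_)
    (convexOn_exp.2 (Set.mem_univ _) (Set.mem_univ _) hp hq hpq)
  simp only [smul_eq_mul, Finset.mul_sum, ← Finset.sum_add_distrib]
  refine Finset.sum_le_sum fun i _ => ?_
  have h1 : (0:ℝ) < 1 + k * u i := by have := mul_nonneg hk (hu i); linarith
  have h2 : (0:ℝ) < 1 + k * v i := by have := mul_nonneg hk (hv i); linarith
  have h := strictConcaveOn_log_Ioi.concaveOn.2 (Set.mem_Ioi.2 h1) (Set.mem_Ioi.2 h2) hp hq hpq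
  simp only [smul_eq_mul] at h
  have e : p * (1 + k * u i) + q * (1 + k * v i) = 1 + k * (p • u + q • v) i := by
    simp only [Pi.add_apply, Pi.smul_apply, smul_eq_mul]
    linear_combination hpq
  rw [e] at h
  have := mul_le_mul_of_nonneg_right h (ha i).le
  linarith

/-- for `k ≥ 0` and positive exponents `a₁, …, a_N`, the symmetrized
function `ψ(x) = ∑_{σ ∈ S_N} ∏ᵢ (1 + k x_{σ(i)})^{-aᵢ}` is Schur-convex on the
nonnegative orthant: if `x, y ∈ [0,∞)^N` and `x` majorizes `y`, then `ψ x ≥ ψ y`. -/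
theorem stmt_9 {N : ℕ} (hN : 1 ≤ N) (k : ℝ) (hk : 0 ≤ k)
    (a : Fin N → ℝ) (ha : ∀ i, 0 < a i)
    (x y : Fin N → ℝ) (hx : ∀ i, 0 ≤ x i) (hy : ∀ i, 0 ≤ y i)
    (hmaj : Majorizes x y) :
    ∑ σ : Equiv.Perm (Fin N), ∏ i, (1 + k * y (σ i)) ^ (-(a i)) ≤
      ∑ σ : Equiv.Perm (Fin N), ∏ i, (1 + k * x (σ i)) ^ (-(a i)) := by
  obtain ⟨S, hS, rfl⟩ := hmaj
  obtain ⟨w, hw, hw1, rfl⟩ := exists_eq_sum_perm_of_mem_doublyStochastic hS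
  have hc := aux_convex k hk a ha
  have key : ∀ σ : Equiv.Perm (Fin N),
      ∏ i, (1 + k * ((∑ τ, w τ • τ.permMatrix ℝ : Matrix (Fin N) (Fin N) ℝ).mulVec x) (σ i))
        ^ (-(a i)) ≤ ∑ τ : Equiv.Perm (Fin N), w τ * ∏ i, (1 + k * x (τ (σ i))) ^ (-(a i)) := by
    intro σ
    have h := hc.map_sum_le (t := Finset.univ) (w := w)
      (p := fun τ : Equiv.Perm (Fin N) => fun i => x (τ (σ i)))
      (fun τ _ => hw τ) hw1 (fun τ _ i => hx _)
    have e : ∀ i, ((∑ τ, w τ • τ.permMatrix ℝ : Matrix (Fin N) (Fin N) ℝ).mulVec x) (σ i) =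
        (∑ τ : Equiv.Perm (Fin N), w τ • (fun i => x (τ (σ i)))) i := by
      intro i
      simp [Matrix.sum_mulVec, Matrix.smul_mulVec, Matrix.permMatrix_mulVec, Finset.sum_apply]
    simp only [e]
    exact h
  refine (Finset.sum_le_sum fun σ _ => key σ).trans ?_
  rw [Finset.sum_comm]
  simp only [← Finset.mul_sum]
  have : ∀ τ : Equiv.Perm (Fin N),
      ∑ σ : Equiv.Perm (Fin N), ∏ i, (1 + k * x (τ (σ i))) ^ (-(a i)) =
      ∑ σ : Equiv.Perm (Fin N), ∏ i, (1 + k * x (σ i)) ^ (-(a i)) := fun τ =>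
    Equiv.sum_comp (Equiv.mulLeft τ)
      (fun σ : Equiv.Perm (Fin N) => ∏ i, (1 + k * x (σ i)) ^ (-(a i)))
  simp only [this, ← Finset.sum_mul, hw1, one_mul, le_refl]
end

section
/- (Coverage comparison when the user's shape parameter is at most one.) Let $0 < m \le 1$, $m_c > 0$, $k > 0$, and $N \ge 1$. For a vector $\lambda = (\lambda_1, \ldots, \lambda_N)$ with nonnegative entries, define the coverage probability $C(\lambda) = \frac{\Gamma(N m_c + m)}{\Gamma(N m_c + 1)\,\Gamma(m)} \prod_{i=1}^{N} \left(\frac{1}{1 + k m \lambda_i}\right)^{m_c} \sum_{i_1, \ldots, i_N \ge 0} \frac{(1-m)_{i_1 + \cdots + i_N}\, (m_c)_{i_1} \cdots (m_c)_{i_N}}{(N m_c + 1)_{i_1 + \cdots + i_N}} \prod_{j=1}^{N} \frac{1}{i_j!} \left(\frac{1}{1 + k m \lambda_j}\right)^{i_j}$. If $\hat{\lambda} = (\hat{\lambda}_1, \ldots, \hat{\lambda}_N)$ is a vector with nonnegative entries that majorizes $\lambda$, then $C(\hat{\lambda}) \ge C(\lambda)$. -/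
open Matrix

/-- The coverage probability of a user with Nakagami-m shape `m`, common interferer
shape `mc`, constant `k = T r^α`, and interferer power vector `lam`; the series is the
Lauricella function of the fourth kind, written as an unordered sum over multi-indices.
`(a)_n` is the rising Pochhammer symbol `(ascPochhammer ℝ n).eval a`. -/
noncomputable def coverage {N : ℕ} (m mc k : ℝ) (lam : Fin N → ℝ) : ℝ :=
  (Real.Gamma ((N : ℝ) * mc + m) / (Real.Gamma ((N : ℝ) * mc + 1) * Real.Gamma m)) *
    (∏ i, (1 / (1 + k * m * lam i)) ^ mc) *
    ∑' i : Fin N → ℕ,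
      (((ascPochhammer ℝ (∑ j, i j)).eval (1 - m) *
          ∏ j, (ascPochhammer ℝ (i j)).eval mc) /
        (ascPochhammer ℝ (∑ j, i j)).eval ((N : ℝ) * mc + 1)) *
        ∏ j, (1 / (Nat.factorial (i j) : ℝ)) * (1 / (1 + k * m * lam j)) ^ (i j)

lemma aux_choose (a : ℝ) (n : ℕ) :
    Ring.choose (-a) n = (-1) ^ n * ((ascPochhammer ℝ n).eval a / (n.factorial : ℝ)) := by
  have hf : (n.factorial : ℝ) ≠ 0 := by positivity
  have h1 := Ring.factorial_nsmul_multichoose_eq_ascPochhammer a n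
  rw [Polynomial.ascPochhammer_smeval_eq_eval, nsmul_eq_mul] at h1
  rw [Ring.choose_neg', ← h1, mul_div_cancel_left₀ _ hf]
  rcases Nat.even_or_odd n with h | h
  · rw [Int.negOnePow_even _ (by exact_mod_cast h), h.neg_one_pow]; simp
  · rw [Int.negOnePow_odd _ (by exact_mod_cast h), h.neg_one_pow]; simp

lemma aux_vander {N : ℕ} (mc : ℝ) (n : ℕ) :
    ∑ l ∈ Finset.finsuppAntidiag (Finset.univ : Finset (Fin N)) n,
      ∏ j, ((ascPochhammer ℝ (l j)).eval mc / ((l j).factorial : ℝ)) =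
    (ascPochhammer ℝ n).eval (N * mc) / (n.factorial : ℝ) := by
  have h : ∀ M : ℕ, ∏ j : Fin M, PowerSeries.binomialSeries ℝ (-mc) =
      PowerSeries.binomialSeries ℝ (-(M * mc) : ℝ) := by
    intro M
    induction M with
    | zero => simp
    | succ M ih =>
      rw [Fin.prod_univ_succ, ih, ← PowerSeries.binomialSeries_add]
      congr 1; push_cast; ring
  have h2 := congrArg (PowerSeries.coeff n) (h N)
  rw [PowerSeries.coeff_prod, PowerSeries.binomialSeries_coeff, aux_choose] at h2
  have h3 : ∀ l ∈ Finset.finsuppAntidiag (Finset.univ : Finset (Fin N)) n,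
      ∏ j, PowerSeries.coeff (l j) (PowerSeries.binomialSeries ℝ (-mc)) =
      (-1) ^ n * ∏ j, ((ascPochhammer ℝ (l j)).eval mc / ((l j).factorial : ℝ)) := by
    intro l hl
    have hs : ∑ j, l j = n := (Finset.mem_finsuppAntidiag.1 hl).1
    rw [← hs, ← Finset.prod_pow_eq_pow_sum, ← Finset.prod_mul_distrib]
    refine Finset.prod_congr rfl fun j _ => ?_
    rw [PowerSeries.binomialSeries_coeff, aux_choose, smul_eq_mul, mul_one]
  rw [Finset.sum_congr rfl h3, ← Finset.mul_sum, smul_eq_mul, mul_one] at h2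
  exact mul_left_cancel₀ (by simp) h2

lemma aux_succ (a : ℝ) (n : ℕ) : (ascPochhammer ℝ (n+1)).eval a =
    (ascPochhammer ℝ n).eval a * (a + n) := by
  exact ascPochhammer_succ_eval n a

lemma aux_nonneg (a : ℝ) (ha : 0 ≤ a) (n : ℕ) : 0 ≤ (ascPochhammer ℝ n).eval a := by
  induction n with
  | zero => simp
  | succ n ih => rw [aux_succ]; positivity

lemma aux_pos (a : ℝ) (ha : 0 < a) (n : ℕ) : 0 < (ascPochhammer ℝ n).eval a :=
  ascPochhammer_pos n a ha

/-- shift ratio -/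
lemma aux_ratio (M : ℝ) (n : ℕ) :
    (ascPochhammer ℝ n).eval M * (M + n) = M * (ascPochhammer ℝ n).eval (M + 1) := by
  induction n with
  | zero => simp
  | succ n ih => rw [aux_succ, aux_succ, ih]; push_cast; ring

lemma aux_tele (m : ℝ) (hm0 : 0 < m) (K : ℕ) :
    ∑ n ∈ Finset.range K, (ascPochhammer ℝ n).eval (1 - m) / (n.factorial : ℝ) / (n + 1) =
      (1 - (ascPochhammer ℝ K).eval (1 - m) / (K.factorial : ℝ)) / m := by
  induction K with
  | zero => simp
  | succ K ih =>
    rw [Finset.sum_range_succ, ih, aux_succ, Nat.factorial_succ]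
    have hf : (K.factorial : ℝ) ≠ 0 := by positivity
    have : (K + 1 : ℝ) ≠ 0 := by positivity
    push_cast
    field_simp
    ring

noncomputable def cf {N : ℕ} (m mc : ℝ) (i : Fin N → ℕ) : ℝ :=
  (((ascPochhammer ℝ (∑ j, i j)).eval (1 - m) *
          ∏ j, (ascPochhammer ℝ (i j)).eval mc) /
        (ascPochhammer ℝ (∑ j, i j)).eval ((N : ℝ) * mc + 1)) *
        ∏ j, (1 / (Nat.factorial (i j) : ℝ))

lemma cf_nonneg {N : ℕ} (m mc : ℝ) (hm1 : m ≤ 1) (hmc : 0 < mc) (i : Fin N → ℕ) :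
    0 ≤ cf m mc i := by
  unfold cf
  have h1 := aux_nonneg (1 - m) (by linarith) (∑ j, i j)
  have h2 := aux_nonneg ((N:ℝ) * mc + 1) (by positivity) (∑ j, i j)
  have h3 : 0 ≤ ∏ j, (ascPochhammer ℝ (i j)).eval mc :=
    Finset.prod_nonneg fun j _ => aux_nonneg mc hmc.le _
  have h4 : 0 ≤ ∏ j, (1 / (Nat.factorial (i j) : ℝ)) :=
    Finset.prod_nonneg fun j _ => by positivity
  positivity

lemma cf_perm {N : ℕ} (m mc : ℝ) (i : Fin N → ℕ) (σ : Equiv.Perm (Fin N)) :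
    cf m mc (i ∘ σ) = cf m mc i := by
  unfold cf
  have h1 : ∑ j, (i ∘ σ) j = ∑ j, i j := Equiv.sum_comp σ i
  have h2 : ∏ j, (ascPochhammer ℝ ((i ∘ σ) j)).eval mc = ∏ j, (ascPochhammer ℝ (i j)).eval mc :=
    Equiv.prod_comp σ (fun j => (ascPochhammer ℝ (i j)).eval mc)
  have h3 : ∏ j, (1 / (Nat.factorial ((i ∘ σ) j) : ℝ)) = ∏ j, (1 / (Nat.factorial (i j) : ℝ)) :=
    Equiv.prod_comp σ (fun j => (1 / (Nat.factorial (i j) : ℝ)))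
  rw [h1, h2, h3]

lemma cf_summable {N : ℕ} (hN : 1 ≤ N) (m mc : ℝ) (hm0 : 0 < m) (hm1 : m ≤ 1) (hmc : 0 < mc) :
    Summable (fun i : Fin N → ℕ => cf m mc i) := by
  set M : ℝ := N * mc with hMdef
  have hM : 0 < M := by
    have : (0:ℝ) < N := by exact_mod_cast hN
    positivity
  refine summable_of_sum_le (c := (M + 1) * (1 / m)) (fun i => cf_nonneg m mc hm1 hmc i) ?_
  intro u
  obtain ⟨K, hK⟩ : ∃ K, ∀ i ∈ u, ∑ j, i j < K :=
    ⟨u.sup (fun i => ∑ j, i j) + 1, fun i hi =>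
      Nat.lt_succ_of_le (Finset.le_sup (f := fun i : Fin N → ℕ => ∑ j, i j) hi)⟩
  rw [← Finset.sum_fiberwise_of_maps_to (t := Finset.range K) (g := fun i => ∑ j, i j)
    (fun i hi => Finset.mem_range.2 (hK i hi))]
  have key : ∀ n ∈ Finset.range K, ∑ i ∈ u with ∑ j, i j = n, cf m mc i ≤
      (M + 1) * ((ascPochhammer ℝ n).eval (1 - m) / (n.factorial : ℝ) / (n + 1)) := by
    intro n _
    have h1 : ∑ i ∈ u with ∑ j, i j = n, cf m mc i ≤
        ∑ l ∈ Finset.finsuppAntidiag (Finset.univ : Finset (Fin N)) n, cf m mc l := by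
      have e0 : ∑ l ∈ Finset.finsuppAntidiag (Finset.univ : Finset (Fin N)) n, cf m mc l =
          ∑ i ∈ (Finset.finsuppAntidiag (Finset.univ : Finset (Fin N)) n).map
            (Finsupp.equivFunOnFinite (α := Fin N) (M := ℕ)).toEmbedding, cf m mc i := by
        rw [Finset.sum_map]; rfl
      rw [e0]
      refine Finset.sum_le_sum_of_subset_of_nonneg ?_ (fun i _ _ => cf_nonneg m mc hm1 hmc i)
      intro i hi
      rw [Finset.mem_map]
      refine ⟨Finsupp.equivFunOnFinite.symm i, ?_, by simp⟩
      rw [Finset.mem_finsuppAntidiag]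
      exact ⟨by simpa using (Finset.mem_filter.1 hi).2, by simp⟩
    have h2 : ∑ l ∈ Finset.finsuppAntidiag (Finset.univ : Finset (Fin N)) n, cf m mc l =
        (ascPochhammer ℝ n).eval (1 - m) / (ascPochhammer ℝ n).eval (M + 1) *
        ((ascPochhammer ℝ n).eval M / (n.factorial : ℝ)) := by
      rw [hMdef, ← aux_vander, Finset.mul_sum]
      refine Finset.sum_congr rfl fun l hl => ?_
      have hs : ∑ j, l j = n := (Finset.mem_finsuppAntidiag.1 hl).1
      unfold cf
      rw [hs, Finset.prod_div_distrib, Finset.prod_div_distrib]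
      simp only [Finset.prod_const_one]
      ring
    rw [h2] at h1
    refine h1.trans ?_
    have p1 := aux_pos (M + 1) (by positivity) n
    have p2 := aux_nonneg (1 - m) (by linarith) n
    have p3 : (0:ℝ) < n.factorial := by positivity
    have e : (ascPochhammer ℝ n).eval M = M * (ascPochhammer ℝ n).eval (M + 1) / (M + n) := by
      rw [← aux_ratio M n]; field_simp
    have e2 : (ascPochhammer ℝ n).eval (1 - m) / (ascPochhammer ℝ n).eval (M + 1) *
        ((ascPochhammer ℝ n).eval M / (n.factorial : ℝ)) =
        ((ascPochhammer ℝ n).eval (1 - m) / n.factorial) * (M / (M + n)) := by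
      rw [e]; field_simp
    have e3 : M / (M + n) ≤ (M + 1) / (n + 1) := by
      rw [div_le_div_iff₀ (by positivity) (by positivity)]
      nlinarith [sq_nonneg M, (Nat.cast_nonneg n : (0:ℝ) ≤ n)]
    rw [e2]
    calc _ ≤ ((ascPochhammer ℝ n).eval (1 - m) / n.factorial) * ((M + 1) / (n + 1)) := by gcongr
      _ = _ := by ring
  refine (Finset.sum_le_sum key).trans ?_
  rw [← Finset.mul_sum, aux_tele m hm0]
  have := aux_nonneg (1 - m) (by linarith) K
  gcongr
  have : 0 ≤ (ascPochhammer ℝ K).eval (1 - m) / (K.factorial : ℝ) := by positivity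
  linarith

/-- monomials -/
noncomputable def mo {N : ℕ} (mc c : ℝ) (i : Fin N → ℕ) (x : Fin N → ℝ) : ℝ :=
  ∏ j, ((1 / (1 + c * x j)) ^ mc * (1 / (1 + c * x j)) ^ (i j))

lemma mo_nonneg {N : ℕ} (mc c : ℝ) (hc : 0 < c) (i : Fin N → ℕ) (x : Fin N → ℝ)
    (hx : ∀ j, 0 ≤ x j) : 0 ≤ mo mc c i x :=
  Finset.prod_nonneg fun j _ => by have := hx j; positivity

lemma mo_le {N : ℕ} (mc c : ℝ) (hc : 0 < c) (hmc : 0 < mc) (i : Fin N → ℕ) (x : Fin N → ℝ)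
    (hx : ∀ j, 0 ≤ x j) : mo mc c i x ≤ 1 := by
  refine Finset.prod_le_one (fun j _ => by have := hx j; positivity) fun j _ => ?_
  have := hx j
  have h1 : 1 / (1 + c * x j) ≤ 1 := by
    rw [div_le_one (by positivity)]; nlinarith [mul_nonneg hc.le this]
  exact mul_le_one₀ (Real.rpow_le_one (by positivity) h1 hmc.le) (by positivity)
    (pow_le_one₀ (by positivity) h1)

lemma mo_perm {N : ℕ} (mc c : ℝ) (i : Fin N → ℕ) (x : Fin N → ℝ) (σ : Equiv.Perm (Fin N)) :
    mo mc c (i ∘ σ) (x ∘ σ) = mo mc c i x :=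
  Equiv.prod_comp σ (fun j => ((1 / (1 + c * x j)) ^ mc * (1 / (1 + c * x j)) ^ (i j)))

lemma mo_convex {N : ℕ} (mc c : ℝ) (hc : 0 < c) (hmc : 0 < mc) (i : Fin N → ℕ) :
    ConvexOn ℝ {x : Fin N → ℝ | ∀ j, 0 ≤ x j} (mo mc c i) := by
  have hcv : Convex ℝ {x : Fin N → ℝ | ∀ j, 0 ≤ x j} := by
    intro x hx y hy a b ha hb hab j
    have := hx j; have := hy j
    simp only [Pi.add_apply, Pi.smul_apply, smul_eq_mul]
    positivity
  have h1 : ConvexOn ℝ {x : Fin N → ℝ | ∀ j, 0 ≤ x j}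
      (fun x => ∑ j, (mc + i j) * (-Real.log (1 + c * x j))) := by
    refine ⟨hcv, ?_⟩
    intro x hx y hy a b ha hb hab
    simp only [smul_eq_mul, Finset.mul_sum, ← Finset.sum_add_distrib]
    refine Finset.sum_le_sum fun j _ => ?_
    have hxj := hx j; have hyj := hy j
    have := strictConcaveOn_log_Ioi.concaveOn.2 (x := 1 + c * x j) (y := 1 + c * y j)
      (Set.mem_Ioi.2 (by positivity)) (Set.mem_Ioi.2 (by positivity)) ha hb hab
    simp only [smul_eq_mul] at this
    have e : a * (1 + c * x j) + b * (1 + c * y j) = 1 + c * (a • x + b • y) j := by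
      simp only [Pi.add_apply, Pi.smul_apply, smul_eq_mul]
      linear_combination hab
    rw [e] at this
    have h0 : 0 ≤ mc + i j := by positivity
    nlinarith [mul_le_mul_of_nonneg_left this h0]
  have h2 : ConvexOn ℝ {x : Fin N → ℝ | ∀ j, 0 ≤ x j}
      (Real.exp ∘ (fun x => ∑ j, (mc + i j) * (-Real.log (1 + c * x j)))) := by
    refine ⟨hcv, ?_⟩
    intro x hx y hy a b ha hb hab
    refine (Real.exp_le_exp.2 (h1.2 hx hy ha hb hab)).trans ?_
    exact convexOn_exp.2 (Set.mem_univ _) (Set.mem_univ _) ha hb hab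
  refine h2.congr ?_
  intro x hx
  simp only [Function.comp, mo, Real.exp_sum]
  refine Finset.prod_congr rfl fun j _ => ?_
  have hxj := hx j
  have hp : 0 < 1 + c * x j := by positivity
  rw [← Real.rpow_natCast, ← Real.rpow_add (by positivity), Real.rpow_def_of_pos (by positivity),
    one_div, Real.log_inv, mul_comm]

lemma coverage_eq' {N : ℕ} (m mc k : ℝ) (lam : Fin N → ℝ) :
  (Real.Gamma ((N : ℝ) * mc + m) / (Real.Gamma ((N : ℝ) * mc + 1) * Real.Gamma m)) *
    (∏ i, (1 / (1 + k * m * lam i)) ^ mc) *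
    ∑' i : Fin N → ℕ,
      (((ascPochhammer ℝ (∑ j, i j)).eval (1 - m) *
          ∏ j, (ascPochhammer ℝ (i j)).eval mc) /
        (ascPochhammer ℝ (∑ j, i j)).eval ((N : ℝ) * mc + 1)) *
        ∏ j, (1 / (Nat.factorial (i j) : ℝ)) * (1 / (1 + k * m * lam j)) ^ (i j) =
  (Real.Gamma ((N : ℝ) * mc + m) / (Real.Gamma ((N : ℝ) * mc + 1) * Real.Gamma m)) *
    ∑' i : Fin N → ℕ, cf m mc i * mo mc (k * m) i lam := by
  rw [mul_assoc, ← tsum_mul_left]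
  congr 1
  refine tsum_congr fun i => ?_
  unfold cf mo
  rw [Finset.prod_mul_distrib, Finset.prod_mul_distrib]
  ring

lemma term_summable {N : ℕ} (hN : 1 ≤ N) (m mc c : ℝ) (hm0 : 0 < m) (hm1 : m ≤ 1) (hmc : 0 < mc)
    (hc : 0 < c) (x : Fin N → ℝ) (hx : ∀ j, 0 ≤ x j) :
    Summable (fun i : Fin N → ℕ => cf m mc i * mo mc c i x) :=
  Summable.of_nonneg_of_le
    (fun i => mul_nonneg (cf_nonneg m mc hm1 hmc i) (mo_nonneg mc c hc i x hx))
    (fun i => mul_le_of_le_one_right (cf_nonneg m mc hm1 hmc i) (mo_le mc c hc hmc i x hx))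
    (cf_summable hN m mc hm0 hm1 hmc)

lemma tsum_perm {N : ℕ} (m mc c : ℝ) (x : Fin N → ℝ) (σ : Equiv.Perm (Fin N)) :
    ∑' i : Fin N → ℕ, cf m mc i * mo mc c i (x ∘ σ) =
    ∑' i : Fin N → ℕ, cf m mc i * mo mc c i x := by
  rw [← (Equiv.arrowCongr σ.symm (Equiv.refl ℕ)).tsum_eq]
  refine tsum_congr fun i => ?_
  have : (Equiv.arrowCongr σ.symm (Equiv.refl ℕ)) i = i ∘ σ := by
    ext j; simp [Equiv.arrowCongr]
  rw [this, cf_perm, mo_perm]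

lemma main_ineq {N : ℕ} (hN : 1 ≤ N) (m mc c : ℝ) (hm0 : 0 < m) (hm1 : m ≤ 1) (hmc : 0 < mc)
    (hc : 0 < c) (x y : Fin N → ℝ) (hx : ∀ j, 0 ≤ x j)
    (h : ∃ S ∈ doublyStochastic ℝ (Fin N), y = S.mulVec x) :
    ∑' i : Fin N → ℕ, cf m mc i * mo mc c i y ≤ ∑' i : Fin N → ℕ, cf m mc i * mo mc c i x := by
  obtain ⟨S, hS, rfl⟩ := h
  obtain ⟨w, hw0, hw1, hwS⟩ := exists_eq_sum_perm_of_mem_doublyStochastic hS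
  have hy : S.mulVec x = ∑ σ : Equiv.Perm (Fin N), w σ • (x ∘ σ) := by
    rw [← hwS, Matrix.sum_mulVec]
    refine Finset.sum_congr rfl fun σ _ => ?_
    rw [Matrix.smul_mulVec, Matrix.permMatrix_mulVec]
  have hxs : ∀ σ : Equiv.Perm (Fin N), ∀ j, 0 ≤ (x ∘ σ) j := fun σ j => hx _
  have hyn : ∀ j, 0 ≤ (S.mulVec x) j := by
    intro j
    rw [hy, Finset.sum_apply]
    exact Finset.sum_nonneg fun σ _ => mul_nonneg (hw0 σ) (hxs σ j)
  have hsum : ∀ σ ∈ (Finset.univ : Finset (Equiv.Perm (Fin N))),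
      Summable (fun i : Fin N → ℕ => w σ * (cf m mc i * mo mc c i (x ∘ σ))) := fun σ _ =>
    (term_summable hN m mc c hm0 hm1 hmc hc _ (hxs σ)).mul_left _
  calc ∑' i : Fin N → ℕ, cf m mc i * mo mc c i (S.mulVec x)
      ≤ ∑' i : Fin N → ℕ, ∑ σ, w σ * (cf m mc i * mo mc c i (x ∘ σ)) := by
        refine Summable.tsum_le_tsum ?_ (term_summable hN m mc c hm0 hm1 hmc hc _ hyn)
          (summable_sum hsum)
        intro i
        rw [hy]
        have := (mo_convex (N := N) mc c hc hmc i).map_sum_le (t := Finset.univ) (w := w)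
          (p := fun σ : Equiv.Perm (Fin N) => x ∘ σ) (fun σ _ => hw0 σ) hw1 (fun σ _ => hxs σ)
        refine (mul_le_mul_of_nonneg_left this (cf_nonneg m mc hm1 hmc i)).trans_eq ?_
        rw [Finset.mul_sum]
        refine Finset.sum_congr rfl fun σ _ => ?_
        rw [smul_eq_mul]; ring
    _ = ∑ σ, ∑' i : Fin N → ℕ, w σ * (cf m mc i * mo mc c i (x ∘ σ)) :=
        Summable.tsum_finsetSum hsum
    _ = ∑ σ, w σ * ∑' i : Fin N → ℕ, cf m mc i * mo mc c i x := by
        refine Finset.sum_congr rfl fun σ _ => ?_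
        rw [tsum_mul_left, tsum_perm]
    _ = _ := by rw [← Finset.sum_mul, hw1, one_mul]

/-- coverage comparison when the user's shape parameter is at most one:
for `0 < m ≤ 1`, `mc > 0`, `k > 0`, `N ≥ 1`, and nonnegative vectors `lam`, `lamHat`
such that `lamHat` majorizes `lam`, the coverage probability satisfies
`coverage m mc k lamHat ≥ coverage m mc k lam`. -/
theorem stmt_10 {N : ℕ} (hN : 1 ≤ N) (m mc k : ℝ)
    (hm0 : 0 < m) (hm1 : m ≤ 1) (hmc : 0 < mc) (hk : 0 < k)
    (lam lamHat : Fin N → ℝ) (hlam : ∀ i, 0 ≤ lam i) (hlamHat : ∀ i, 0 ≤ lamHat i)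
    (hmaj : Majorizes lamHat lam) :
    coverage m mc k lam ≤ coverage m mc k lamHat := by
  have hc : 0 < k * m := mul_pos hk hm0
  have hNp : (0:ℝ) < N := by exact_mod_cast hN
  unfold coverage
  rw [coverage_eq', coverage_eq']
  refine mul_le_mul_of_nonneg_left
    (main_ineq hN m mc (k * m) hm0 hm1 hmc hc lamHat lam hlamHat hmaj) ?_
  have g1 := Real.Gamma_pos_of_pos (show 0 < (N:ℝ) * mc + m by positivity)
  have g2 := Real.Gamma_pos_of_pos (show 0 < (N:ℝ) * mc + 1 by positivity)
  have g3 := Real.Gamma_pos_of_pos hm0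
  positivity
end
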